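/- arXiv:1911.07491 — 2 statements merged into one kernel-verified Lean document; each statement's English description precedes it below -/
import Mathlib

section
/- Let $x, y$ be commuting bounded self-adjoint operators on a Hilbert space. Then $x \preceq y$ in the spectral order if and only if $x \le y$ in the L\"owner order. In particular, on any commutative C*-algebra $C(X)$ the spectral order coincides with the pointwise order. -/
noncomputable section

/-- `E` is the spectral family (resolution of identity) of the self-adjoint element `x`,
i.e. `E l` is the spectral projection `χ_{(-∞,l]}(x)`. -/
def IsSpectralFamily {A : Type*} [Ring A] [StarRing A] [PartialOrder A] [Module ℝ A]
    (x : A) (E : ℝ → A) : Prop :=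
  (∀ l, IsSelfAdjoint (E l)) ∧ (∀ l, IsIdempotentElem (E l)) ∧
  Monotone E ∧
  (∀ l, IsGLB (E '' Set.Ioi l) (E l)) ∧
  (∃ a : ℝ, 0 < a ∧ (∀ l, l < -a → E l = 0) ∧ (∀ l, a < l → E l = 1)) ∧
  (∀ l, x * E l ≤ l • E l ∧ l • (1 - E l) ≤ x * (1 - E l))

/-- The spectral order: `x ⪯ y` iff `E^y_l ≤ E^x_l` for every `l : ℝ`. -/
def SpecLE {A : Type*} [Ring A] [StarRing A] [PartialOrder A] [Module ℝ A] (x y : A) : Prop :=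
  ∀ E F : ℝ → A, IsSpectralFamily x E → IsSpectralFamily y F → ∀ l, F l ≤ E l


section helpers

variable {A : Type*} [CStarAlgebra A] [PartialOrder A] [StarOrderedRing A]

/-- Basic consequences of being a spectral family: star projections commuting with `x`. -/
lemma IsSpectralFamily.proj {x : A} {E : ℝ → A} (h : IsSpectralFamily x E) (l : ℝ) :
    IsStarProjection (E l) := ⟨h.2.1 l, h.1 l⟩

lemma IsSpectralFamily.comm {x : A} {E : ℝ → A} (hx : IsSelfAdjoint x)
    (h : IsSpectralFamily x E) (l : ℝ) : Commute x (E l) := by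
  have h1 := (h.2.2.2.2.2 l).1
  have h2 : IsSelfAdjoint (l • E l - x * E l) := .of_nonneg (sub_nonneg.2 h1)
  have h3 : IsSelfAdjoint (l • E l) := (IsSelfAdjoint.all l).smul (h.1 l)
  have h4 : IsSelfAdjoint (x * E l) := by simpa using h3.sub h2
  have h5 := h4.star_eq
  rw [star_mul, hx.star_eq, (h.1 l).star_eq] at h5
  exact h5.symm

lemma IsSpectralFamily.mul_left {x : A} {E : ℝ → A} (h : IsSpectralFamily x E)
    {l m : ℝ} (hlm : l ≤ m) : E l * E m = E l :=
  ((h.proj l).le_iff_mul_eq_left (h.proj m)).1 (h.2.2.1 hlm)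

lemma IsSpectralFamily.mul_right {x : A} {E : ℝ → A} (h : IsSpectralFamily x E)
    {l m : ℝ} (hlm : l ≤ m) : E m * E l = E l :=
  ((h.proj l).le_iff_mul_eq_right (h.proj m)).1 (h.2.2.1 hlm)

/-- Bounds on the block `E m - E l`. -/
lemma IsSpectralFamily.block {x : A} {E : ℝ → A} (hx : IsSelfAdjoint x)
    (h : IsSpectralFamily x E) {l m : ℝ} (hlm : l ≤ m) :
    x * (E m - E l) ≤ m • (E m - E l) ∧ l • (E m - E l) ≤ x * (E m - E l) := by
  have hP := h.proj
  have e1 := h.mul_left hlm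
  have e2 := h.mul_right hlm
  have hm := (h.2.1 m).eq
  have hl := (h.2.1 l).eq
  have cm := (h.comm hx m).eq
  have cl := (h.comm hx l).eq
  have i1 := IsSelfAdjoint.conjugate_le_conjugate (h.2.2.2.2.2 m).1 (hP l).one_sub.isSelfAdjoint
  have i2 := IsSelfAdjoint.conjugate_le_conjugate (h.2.2.2.2.2 l).2 (hP m).isSelfAdjoint
  have k1 : (1 - E l) * E m * (1 - E l) = E m - E l := by
    simp only [sub_mul, mul_sub, one_mul, mul_one, e1, e2, hl]; abel
  have k2 : E m * (1 - E l) * E m = E m - E l := by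
    simp only [sub_mul, mul_sub, one_mul, mul_one, e1, e2, hm]
  have k3 : (1 - E l) * (x * E m) * (1 - E l) = x * (E m - E l) := by
    rw [← k1, ← mul_assoc, ← mul_assoc, ← mul_assoc]
    simp only [sub_mul, mul_sub, one_mul, mul_one, cl]
  have k4 : E m * (x * (1 - E l)) * E m = x * (E m - E l) := by
    rw [← k2, ← mul_assoc, ← mul_assoc, ← mul_assoc, cm]
  rw [k3, mul_smul_comm, smul_mul_assoc, k1] at i1
  rw [k4, mul_smul_comm, smul_mul_assoc, k2] at i2
  exact ⟨i1, i2⟩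

/-- Riemann-Stieltjes sandwich. -/
lemma IsSpectralFamily.riemann {x : A} {E : ℝ → A} (hx : IsSelfAdjoint x)
    (h : IsSpectralFamily x E) {s d : ℝ} (hd : 0 ≤ d) (hs : E s = 0) (n : ℕ) :
    x * E (s + n * d) ≤
      (s + n * d) • E (s + n * d) - d • ∑ i ∈ Finset.range n, E (s + i * d) ∧
    (s + n * d) • E (s + n * d) - d • ∑ i ∈ Finset.range n, E (s + i * d)
      - d • E (s + n * d) ≤ x * E (s + n * d) := by
  induction n with
  | zero => simp [hs]
  | succ n ih =>
    obtain ⟨b1, b2⟩ := h.block hx (l := s + n * d) (m := s + (n + 1 : ℕ) * d)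
      (by push_cast; nlinarith)
    have hstep : s + ((n + 1 : ℕ) : ℝ) * d = (s + n * d) + d := by push_cast; ring
    rw [hstep] at b1 b2
    rw [hstep, Finset.sum_range_succ]
    set c := s + n * d
    set S := ∑ i ∈ Finset.range n, E (s + i * d)
    have key : x * E (c + d) = x * E c + x * (E (c + d) - E c) := by
      rw [mul_sub]; abel
    rw [key]
    constructor
    · refine (add_le_add ih.1 b1).trans_eq ?_
      module
    · refine le_trans (le_of_eq ?_) (add_le_add ih.2 b2)
      module

lemma spec_forward {x y : A} {E F : ℝ → A} (hx : IsSelfAdjoint x) (hy : IsSelfAdjoint y)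
    (hE : IsSpectralFamily x E) (hF : IsSpectralFamily y F) (hle : ∀ l, F l ≤ E l) :
    x ≤ y := by
  obtain ⟨a, ha, ha0, ha1⟩ := hE.2.2.2.2.1
  obtain ⟨b, hb, hb0, hb1⟩ := hF.2.2.2.2.1
  set s : ℝ := -(a + b + 1) with hs
  set L : ℝ := 2 * (a + b + 1) with hL
  have main : ∀ n : ℕ, x ≤ y + (L / (n + 1 : ℝ)) • (1 : A) := by
    intro n
    set d := L / (n + 1 : ℝ) with hd
    have hd0 : 0 ≤ d := by positivity
    have htop : s + ((n + 1 : ℕ) : ℝ) * d = a + b + 1 := by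
      rw [hd, hs, hL]; push_cast; field_simp; ring
    have r1 := (hE.riemann hx hd0 (ha0 s (by linarith)) (n + 1)).1
    have r2 := (hF.riemann hy hd0 (hb0 s (by linarith)) (n + 1)).2
    rw [htop, ha1 _ (by linarith), mul_one] at r1
    rw [htop, hb1 _ (by linarith), mul_one] at r2
    have hsum : d • ∑ i ∈ Finset.range (n + 1), F (s + i * d) ≤
        d • ∑ i ∈ Finset.range (n + 1), E (s + i * d) :=
      smul_le_smul_of_nonneg_left (Finset.sum_le_sum fun i _ => hle _) hd0
    refine r1.trans ((sub_le_sub_left hsum _).trans ?_)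
    exact sub_le_iff_le_add.1 r2
  have ht : Filter.Tendsto (fun n : ℕ => y + (L / (n + 1 : ℝ)) • (1 : A)) Filter.atTop
      (nhds (y + (0 : ℝ) • (1 : A))) := by
    refine tendsto_const_nhds.add (Filter.Tendsto.smul_const ?_ _)
    have := (tendsto_one_div_add_atTop_nhds_zero_nat (𝕜 := ℝ)).const_mul L
    simpa [div_eq_mul_inv] using this
  have := ge_of_tendsto' ht main
  simpa using this

/-- Identification of the positive and negative part of `x - c`. -/
lemma IsSpectralFamily.parts {x : A} {E : ℝ → A} (hx : IsSelfAdjoint x)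
    (h : IsSpectralFamily x E) (c : ℝ) :
    (x - c • 1)⁺ = (x - c • 1) * (1 - E c) ∧ (x - c • 1)⁻ = (c • 1 - x) * E c := by
  have cm := h.comm hx c
  refine CFC.posPart_negPart_unique ?_ ?_ ?_ ?_
  · noncomm_ring
  · have c2 : Commute (1 - E c) (c • 1 - x) :=
      Commute.sub_left (Commute.one_left _)
        (((Commute.one_right (E c)).smul_right c).sub_right cm.symm)
    rw [mul_assoc, ← mul_assoc (1 - E c), c2.eq, mul_assoc, (h.proj c).one_sub_mul_self]
    simp
  · have := (h.2.2.2.2.2 c).2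
    rw [sub_mul, smul_mul_assoc, one_mul]
    exact sub_nonneg.2 this
  · have := (h.2.2.2.2.2 c).1
    rw [sub_mul, smul_mul_assoc, one_mul]
    exact sub_nonneg.2 this

lemma neg_mul_pos_eq_zero {a b : A} (ha : IsSelfAdjoint a) (hb : IsSelfAdjoint b)
    (hab : Commute a b) (hle : a ≤ b) : b⁻ * a⁺ = 0 := by
  have c1 : Commute a⁺ b := by
    rw [CFC.posPart_def]; exact hab.cfcₙ_real _
  have c2 : Commute b⁻ a⁺ := by
    rw [CFC.negPart_def]; exact c1.symm.cfcₙ_real _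
  have c3 : Commute b⁻ a := by
    rw [CFC.negPart_def]; exact hab.symm.cfcₙ_real _
  have c4 : Commute b⁻ b := by
    rw [CFC.negPart_def]; exact (Commute.refl b).cfcₙ_real _
  have c5 : Commute a⁺ a := by
    rw [CFC.posPart_def]; exact (Commute.refl a).cfcₙ_real _
  have hn : 0 ≤ b⁻ := CFC.negPart_nonneg b
  have hp : 0 ≤ a⁺ := CFC.posPart_nonneg a
  have hq : 0 ≤ b⁻ * a⁺ := Commute.mul_nonneg hn hp c2
  have h1 : 0 ≤ (b - a) * (b⁻ * a⁺) :=
    Commute.mul_nonneg (sub_nonneg.2 hle) hq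
      ((c4.symm.sub_left c3.symm).mul_right (c1.symm.sub_left c5.symm))
  have e1 : b * b⁻ = -(b⁻ * b⁻) := by
    nth_rw 1 [← CFC.posPart_sub_negPart b]
    rw [sub_mul, CFC.posPart_mul_negPart, zero_sub]
  have e2 : a * a⁺ = a⁺ * a⁺ := by
    nth_rw 1 [← CFC.posPart_sub_negPart a]
    rw [sub_mul, CFC.negPart_mul_posPart, sub_zero]
  have e3 : (b - a) * (b⁻ * a⁺) = -(b⁻ * (b⁻ * a⁺) + b⁻ * a⁺ * a⁺) := by
    rw [sub_mul, ← mul_assoc, e1, ← mul_assoc, ← c3.eq, mul_assoc, e2]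
    noncomm_ring
  have p1 : 0 ≤ b⁻ * (b⁻ * a⁺) :=
    Commute.mul_nonneg hn hq ((Commute.refl _).mul_right c2)
  have p2 : 0 ≤ b⁻ * a⁺ * a⁺ :=
    Commute.mul_nonneg hq hp (c2.mul_left (Commute.refl _))
  have z : b⁻ * (b⁻ * a⁺) = 0 := by
    rw [e3] at h1
    exact le_antisymm ((le_add_of_nonneg_right p2).trans (neg_nonneg.1 h1)) p1
  have hsa : IsSelfAdjoint b⁻ := .of_nonneg hn
  rw [← CStarRing.star_mul_self_eq_zero_iff, star_mul, hsa.star_eq, mul_assoc, z, mul_zero]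

lemma eq_zero_of_lower {P S T : A} {δ : ℝ} (hδ : 0 < δ)
    (hS : δ • P ≤ S * P) (hPT : P * T = T) (hz : S * T = 0) : T = 0 := by
  have h := star_left_conjugate_le_conjugate hS T
  have e1 : star T * (S * P) * T = 0 := by
    rw [mul_assoc, mul_assoc, hPT, hz, mul_zero]
  have e2 : star T * (δ • P) * T = δ • (star T * T) := by
    rw [mul_smul_comm, smul_mul_assoc, mul_assoc, hPT]
  rw [e1, e2] at h
  have h0 : δ • (star T * T) = 0 :=
    le_antisymm h (smul_nonneg hδ.le (star_mul_self_nonneg T))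
  exact (CStarRing.star_mul_self_eq_zero_iff T).1 ((smul_eq_zero.1 h0).resolve_left hδ.ne')

lemma spec_backward {x y : A} {E F : ℝ → A} (hx : IsSelfAdjoint x) (hy : IsSelfAdjoint y)
    (hxy : Commute x y) (hE : IsSpectralFamily x E) (hF : IsSpectralFamily y F)
    (hle : x ≤ y) (l : ℝ) : F l ≤ E l := by
  refine (hE.2.2.2.1 l).2 ?_
  rintro _ ⟨m, hm, rfl⟩
  have hm : l < m := hm
  set c := (l + m) / 2 with hc
  have hlc : l < c := by linarith
  have hcm : c < m := by linarith
  have hc1 : IsSelfAdjoint (c • (1 : A)) := (IsSelfAdjoint.all c).smul (.one A)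
  have cc : ∀ z : A, Commute z (c • 1) := fun z => (Commute.one_right z).smul_right c
  have h0 := neg_mul_pos_eq_zero (hx.sub hc1) (hy.sub hc1)
    ((hxy.sub_right (cc x)).sub_left (((cc y).symm).sub_right (Commute.refl _)))
    (sub_le_sub_right hle _)
  rw [(hE.parts hx c).1, (hF.parts hy c).2] at h0
  -- move projections
  have cF : Commute (c • 1 - y) (F l) := ((cc (F l)).symm).sub_left (hF.comm hy l)
  have cE : Commute (x - c • 1) (1 - E m) :=
    (Commute.one_right _).sub_right ((hE.comm hx m).sub_left (cc _).symm)
  have cE' : Commute (x - c • 1) (1 - E c) :=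
    (Commute.one_right _).sub_right ((hE.comm hx c).sub_left (cc _).symm)
  have f1 := hF.mul_left hlc.le
  have g1 : (1 - E c) * (1 - E m) = 1 - E m := by
    simp only [sub_mul, mul_sub, one_mul, mul_one, hE.mul_left hcm.le]; abel
  have h1 : (c • 1 - y) * (F l * (1 - E m) * (x - c • 1)) = 0 := by
    have : F l * (((c • 1 - y) * F c) * ((x - c • 1) * (1 - E c))) * (1 - E m) = 0 := by
      rw [h0]; simp
    rw [← this]
    calc (c • 1 - y) * (F l * (1 - E m) * (x - c • 1))
        = (c • 1 - y) * F l * ((1 - E m) * (x - c • 1)) := by simp only [mul_assoc]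
      _ = (F l * (c • 1 - y)) * ((x - c • 1) * (1 - E m)) := by rw [cF.eq, cE.eq]
      _ = ((c • 1 - y) * (F l * F c)) * ((x - c • 1) * ((1 - E c) * (1 - E m))) := by
          rw [f1, g1, cF.eq]
      _ = ((c • 1 - y) * F l) * F c * ((x - c • 1) * ((1 - E c) * (1 - E m))) := by
          simp only [mul_assoc]
      _ = _ := by rw [cF.eq]; simp only [mul_assoc]
  have low1 : (c - l) • F l ≤ (c • 1 - y) * F l := by
    rw [sub_smul, sub_mul, smul_mul_assoc, one_mul]
    exact sub_le_sub_left (hF.2.2.2.2.2 l).1 _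
  have low2 : (m - c) • (1 - E m) ≤ (x - c • 1) * (1 - E m) := by
    rw [sub_smul, sub_mul, smul_mul_assoc, one_mul]
    exact sub_le_sub_right (hE.2.2.2.2.2 m).2 _
  have h2 : F l * (1 - E m) * (x - c • 1) = 0 :=
    eq_zero_of_lower (sub_pos.2 hlc) low1
      (by rw [← mul_assoc, ← mul_assoc, (hF.2.1 l).eq]) h1
  have h3 : (x - c • 1) * ((1 - E m) * F l) = 0 := by
    have := congrArg star h2
    rwa [star_mul, star_mul, star_zero, (hx.sub hc1).star_eq, (hF.1 l).star_eq,
      (hE.proj m).one_sub.isSelfAdjoint.star_eq] at this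
  have h4 : (1 - E m) * F l = 0 :=
    eq_zero_of_lower (sub_pos.2 hcm) low2
      (by rw [← mul_assoc, (hE.proj m).one_sub.isIdempotentElem.eq]) h3
  refine ((hF.proj l).le_iff_mul_eq_right (hE.proj m)).2 ?_
  rw [sub_mul, one_mul, sub_eq_zero] at h4
  exact h4.symm

end helpers

section continuous

variable {X : Type*} [TopologicalSpace X]

lemma IsSpectralFamily.val {f : C(X, ℝ)} {E : ℝ → C(X, ℝ)} (h : IsSpectralFamily f E)
    (l : ℝ) (p : X) : (E l p = 0 ∧ l ≤ f p) ∨ (E l p = 1 ∧ f p ≤ l) := by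
  have h1 : E l p * E l p = E l p := congrArg (fun g : C(X, ℝ) => g p) (h.2.1 l).eq
  have h2 : f p * E l p ≤ l * E l p := (h.2.2.2.2.2 l).1 p
  have h3 : l * (1 - E l p) ≤ f p * (1 - E l p) := (h.2.2.2.2.2 l).2 p
  have h4 : E l p = 0 ∨ E l p = 1 := by
    have : E l p * (E l p - 1) = 0 := by linarith
    rcases mul_eq_zero.1 this with h | h
    · exact Or.inl h
    · exact Or.inr (by linarith)
  rcases h4 with h4 | h4
  · left; rw [h4] at h3; exact ⟨h4, by linarith⟩
  · right; rw [h4] at h2; exact ⟨h4, by linarith⟩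

lemma spec_continuous {f g : C(X, ℝ)} {E F : ℝ → C(X, ℝ)}
    (hE : IsSpectralFamily f E) (hF : IsSpectralFamily g F) :
    (∀ l, F l ≤ E l) ↔ f ≤ g := by
  constructor
  · intro h p
    by_contra hlt
    replace hlt : g p < f p := not_le.1 hlt
    obtain ⟨l, h1, h2⟩ := exists_between hlt
    have h3 : F l p ≤ E l p := h l p
    rcases hE.val l p with ⟨h4, h6⟩ | ⟨h4, h6⟩ <;>
      rcases hF.val l p with ⟨h5, h7⟩ | ⟨h5, h7⟩ <;> linarith
  · intro h l
    refine (hE.2.2.2.1 l).2 ?_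
    rintro _ ⟨m, hm, rfl⟩
    have hm : l < m := hm
    intro p
    have h3 : f p ≤ g p := h p
    change F l p ≤ E m p
    rcases hE.val m p with ⟨h4, h6⟩ | ⟨h4, h6⟩ <;>
      rcases hF.val l p with ⟨h5, h7⟩ | ⟨h5, h7⟩ <;> linarith

end continuous

variable {H : Type*} [NormedAddCommGroup H] [InnerProductSpace ℂ H] [CompleteSpace H]

/-- For commuting self-adjoint operators the spectral order coincides with the Löwner
order; in particular, on a commutative C*-algebra `C(X)` the spectral order is the
pointwise order. -/
theorem stmt7 :
    (∀ (x y : H →L[ℂ] H), IsSelfAdjoint x → IsSelfAdjoint y → Commute x y →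
      ∀ (Ex Ey : ℝ → (H →L[ℂ] H)), IsSpectralFamily x Ex → IsSpectralFamily y Ey →
        ((∀ l, Ey l ≤ Ex l) ↔ x ≤ y)) ∧
    (∀ (X : Type) [TopologicalSpace X] [CompactSpace X] [T2Space X],
      ∀ (f g : C(X, ℝ)) (Ef Eg : ℝ → C(X, ℝ)),
        IsSpectralFamily f Ef → IsSpectralFamily g Eg →
          ((∀ l, Eg l ≤ Ef l) ↔ f ≤ g)) := by
  refine ⟨?_, ?_⟩
  · intro x y hx hy hxy Ex Ey hEx hEy
    exact ⟨fun h => spec_forward hx hy hEx hEy h,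
      fun h l => spec_backward hx hy hxy hEx hEy h l⟩
  · intro X _ _ _ f g Ef Eg hf hg
    exact spec_continuous hf hg
end
end

section
/- Let $x, y$ be bounded self-adjoint operators on a Hilbert space (or in a von Neumann algebra) with $xy = 0$. Then the supremum of $\{x, y\}$ in the spectral order lattice equals $x^+ + y^+$, where $x^+ = \max(x,0)$ and $y^+ = \max(y,0)$ are the positive parts. -/
noncomputable section

variable {H : Type*} [NormedAddCommGroup H] [InnerProductSpace ℂ H] [CompleteSpace H]

open scoped InnerProductSpace

abbrev SupPos (x : H →L[ℂ] H) (l : ℝ) : H →L[ℂ] H := cfc (fun t : ℝ => max (t - l) 0) x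
abbrev SupNeg (x : H →L[ℂ] H) (l : ℝ) : H →L[ℂ] H := cfc (fun t : ℝ => max (l - t) 0) x

lemma supPos_nonneg (x : H →L[ℂ] H) (l : ℝ) : 0 ≤ SupPos x l :=
  cfc_nonneg (fun t _ => le_max_right _ _)

lemma supNeg_nonneg (x : H →L[ℂ] H) (l : ℝ) : 0 ≤ SupNeg x l :=
  cfc_nonneg (fun t _ => le_max_right _ _)

lemma supPos_sub_supNeg (x : H →L[ℂ] H) (hx : IsSelfAdjoint x) (l : ℝ) :
    SupPos x l - SupNeg x l = x - l • 1 := by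
  rw [SupPos, SupNeg, ← cfc_sub _ _ x (by fun_prop) (by fun_prop)]
  have : x - l • 1 = cfc (fun t : ℝ => t - l) x := by
    rw [cfc_sub _ _ x (by fun_prop) (by fun_prop), cfc_id' ℝ x, cfc_const l x]
    rw [Algebra.algebraMap_eq_smul_one]
  rw [this]
  congr 1
  ext t
  rcases le_total t l with h | h
  · rw [max_eq_right (by linarith), max_eq_left (by linarith)]; ring
  · rw [max_eq_left (by linarith), max_eq_right (by linarith)]; ring

lemma supPos_mul_supNeg (x : H →L[ℂ] H) (hx : IsSelfAdjoint x) (l : ℝ) :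
    SupPos x l * SupNeg x l = 0 := by
  rw [SupPos, SupNeg, ← cfc_mul _ _ x (by fun_prop) (by fun_prop)]
  rw [← cfc_zero ℝ x]
  congr 1
  ext t
  rcases le_total t l with h | h
  · rw [max_eq_right (by linarith : t - l ≤ 0)]; simp
  · rw [max_eq_right (by linarith : l - t ≤ 0)]; simp

lemma supPos_unique (x : H →L[ℂ] H) (hx : IsSelfAdjoint x) (l : ℝ) (b c : H →L[ℂ] H)
    (h : x - l • 1 = b - c) (hbc : b * c = 0) (hb : 0 ≤ b) (hc : 0 ≤ c) : SupPos x l = b := by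
  have h1 := CFC.posPart_negPart_unique h hbc hb hc
  have h2 := CFC.posPart_negPart_unique (supPos_sub_supNeg x hx l).symm
    (supPos_mul_supNeg x hx l) (supPos_nonneg x l) (supNeg_nonneg x l)
  rw [← h1.1, ← h2.1]

lemma apply_eq_zero_of_nonneg (A : H →L[ℂ] H) (hA : 0 ≤ A) (v : H)
    (h : (⟪A v, v⟫_ℂ).re ≤ 0) : A v = 0 := by
  obtain ⟨b, rfl⟩ := CStarAlgebra.nonneg_iff_eq_star_mul_self.mp hA
  have : b v = 0 := by
    rw [mul_apply_eq_comp, ContinuousLinearMap.star_eq_adjoint,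
      ContinuousLinearMap.adjoint_inner_left] at h
    have h2 : RCLike.re ⟪b v, b v⟫_ℂ ≤ 0 := h
    rw [inner_self_eq_norm_sq] at h2
    have : ‖b v‖ = 0 := by nlinarith [norm_nonneg (b v)]
    simpa using this
  simp [this]

lemma re_inner_nonneg (A : H →L[ℂ] H) (hA : 0 ≤ A) (v : H) : 0 ≤ (⟪A v, v⟫_ℂ).re :=
  ((ContinuousLinearMap.nonneg_iff_isPositive A).mp hA).re_inner_nonneg_left v

lemma supPos_ker_mono (x : H →L[ℂ] H) {l m : ℝ} (h : l ≤ m) (v : H)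
    (hv : SupPos x l v = 0) : SupPos x m v = 0 := by
  have h1 : SupPos x m ≤ SupPos x l :=
    cfc_mono (fun t _ => max_le_max_right _ (by linarith)) (by fun_prop) (by fun_prop)
  apply apply_eq_zero_of_nonneg _ (supPos_nonneg x m)
  have := re_inner_nonneg _ (sub_nonneg.mpr h1) v
  simp [hv] at this
  simpa using this

lemma supPos_ker_right (x : H →L[ℂ] H) (l : ℝ) (v : H)
    (hv : ∀ m, l < m → SupPos x m v = 0) : SupPos x l v = 0 := by
  have key : ∀ ε > 0, ‖SupPos x l v‖ ≤ ε * ‖v‖ := by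
    intro ε hε
    have h1 : SupPos x l v = (SupPos x l - SupPos x (l + ε)) v := by
      simp [hv (l + ε) (by linarith)]
    rw [h1]
    refine ContinuousLinearMap.le_of_opNorm_le _ ?_ v
    rw [SupPos, SupPos, ← cfc_sub _ _ x (by fun_prop) (by fun_prop)]
    refine norm_cfc_le hε.le (fun t _ => ?_)
    rw [Real.norm_eq_abs]
    refine (abs_max_sub_max_le_abs _ _ _).trans ?_
    rw [abs_le]; constructor <;> linarith
  have : ‖SupPos x l v‖ ≤ 0 := by
    refine le_of_forall_pos_le_add (fun δ hδ => ?_)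
    have h := key (δ / (‖v‖ + 1)) (by positivity)
    refine h.trans ?_
    rw [zero_add, div_mul_eq_mul_div, div_le_iff₀ (by positivity)]
    nlinarith [norm_nonneg v]
  simpa using this

lemma supPos_ker_low (x : H →L[ℂ] H) (hx : IsSelfAdjoint x) (l : ℝ) (hl : l < -(‖x‖ + 1)) (v : H)
    (hv : SupPos x l v = 0) : v = 0 := by
  have h0 : SupNeg x l = 0 := by
    rw [SupNeg, ← cfc_zero ℝ x]
    refine cfc_congr (fun t ht => ?_)
    have := spectrum.norm_le_norm_mul_of_mem ht
    rw [Real.norm_eq_abs] at this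
    have h2 : ‖(1 : H →L[ℂ] H)‖ ≤ 1 := ContinuousLinearMap.norm_id_le
    have h3 := (abs_le.mp (this.trans (mul_le_of_le_one_right (norm_nonneg x) h2))).1
    exact max_eq_right (by linarith)
  have h1 := supPos_sub_supNeg x hx l
  rw [h0, sub_zero] at h1
  rw [h1] at hv
  have h4 : x v = l • v := by simpa [sub_eq_zero] using hv
  have h5 := x.le_opNorm v
  rw [h4, norm_smul, Real.norm_eq_abs, abs_of_neg (by linarith [norm_nonneg x])] at h5
  have : ‖v‖ = 0 := by nlinarith [norm_nonneg v]
  simpa using this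

lemma supPos_high (x : H →L[ℂ] H) (l : ℝ) (hl : ‖x‖ + 1 < l) : SupPos x l = 0 := by
  rw [SupPos, ← cfc_zero ℝ x]
  refine cfc_congr (fun t ht => ?_)
  have := spectrum.norm_le_norm_mul_of_mem ht
  rw [Real.norm_eq_abs] at this
  have h2 : ‖(1 : H →L[ℂ] H)‖ ≤ 1 := ContinuousLinearMap.norm_id_le
  have h3 := (abs_le.mp (this.trans (mul_le_of_le_one_right (norm_nonneg x) h2))).2
  exact max_eq_right (by linarith)

/-- kernel subspace of `(x-l)⁺` -/
def specKer (x : H →L[ℂ] H) (l : ℝ) : Submodule ℂ H := (SupPos x l).ker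

lemma mem_specKer (x : H →L[ℂ] H) (l : ℝ) (v : H) : v ∈ specKer x l ↔ SupPos x l v = 0 := Iff.rfl

instance specKer_complete (x : H →L[ℂ] H) (l : ℝ) : CompleteSpace (specKer x l) :=
  (ContinuousLinearMap.isClosed_ker (SupPos x l)).completeSpace_coe

/-- canonical spectral projections -/
def specProj (x : H →L[ℂ] H) (l : ℝ) : H →L[ℂ] H := (specKer x l).starProjection

lemma specProj_star (x : H →L[ℂ] H) (l : ℝ) : IsStarProjection (specProj x l) :=
  isStarProjection_starProjection

lemma specProj_le_iff (x y : H →L[ℂ] H) (l m : ℝ) :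
    specProj x l ≤ specProj y m ↔ specKer x l ≤ specKer y m :=
  Submodule.starProjection_le_starProjection_iff

lemma specKer_mono (x : H →L[ℂ] H) : Monotone (specKer x) :=
  fun _ _ h v hv => supPos_ker_mono x h v hv

lemma specProj_glb (x : H →L[ℂ] H) (l : ℝ) :
    IsGLB (specProj x '' Set.Ioi l) (specProj x l) := by
  constructor
  · rintro _ ⟨m, hm, rfl⟩
    exact (specProj_le_iff _ _ _ _).2 (specKer_mono x (le_of_lt hm))
  · intro b hb
    let u : ℕ → ℝ := fun n => l + 1 / ((n : ℝ) + 1)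
    have hu : ∀ n, l < u n := fun n => by
      have : 0 < 1 / ((n : ℝ) + 1) := by positivity
      simp only [u]; linarith
    have hua : Antitone u := by
      intro a c h
      simp only [u]
      gcongr
    have hle : ∀ n, b ≤ specProj x (u n) := fun n => hb ⟨u n, hu n, rfl⟩
    let U : ℕ → Submodule ℂ H := fun n => (specKer x (u n))ᗮ
    have hU : Monotone U := fun a c h => Submodule.orthogonal_le (specKer_mono x (hua h))
    have hsup : (⨆ n, U n).topologicalClosure = (specKer x l)ᗮ := by
      rw [← Submodule.orthogonal_orthogonal_eq_closure, ← Submodule.iInf_orthogonal]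
      congr 1
      ext v
      simp only [U, Submodule.orthogonal_orthogonal, Submodule.mem_iInf, mem_specKer]
      constructor
      · intro h
        apply supPos_ker_right
        intro m hm
        obtain ⟨n, hn⟩ := exists_nat_one_div_lt (sub_pos.mpr hm)
        exact supPos_ker_mono x (by simp only [u]; linarith) v (h n)
      · intro h n
        exact supPos_ker_mono x (hu n).le v h
    have hlim : ∀ v, Filter.Tendsto (fun n => specProj x (u n) v) Filter.atTop
        (nhds (specProj x l v)) := by
      intro v
      have h := Submodule.starProjection_tendsto_closure_iSup U hU v
      have e1 : (⨆ n, U n).topologicalClosure.starProjection v = v - specProj x l v := by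
        simp only [hsup, specProj]
        rw [Submodule.starProjection_orthogonal_val]
      have e2 : ∀ n, (U n).starProjection v = v - specProj x (u n) v := by
        intro n
        simp only [U, specProj]
        rw [Submodule.starProjection_orthogonal_val]
      simp only [e1, e2] at h
      simpa using h.const_sub v
    rw [ContinuousLinearMap.le_def, ContinuousLinearMap.isPositive_iff_complex]
    intro v
    have hsa : ∀ n, (specProj x (u n) - b).IsPositive := fun n => hle n
    have hbsa : IsSelfAdjoint b := by
      have h := (specProj_star x (u 0)).isSelfAdjoint.sub (hsa 0).isSelfAdjoint
      simpa using h
    have hsy := (ContinuousLinearMap.isSelfAdjoint_iff_isSymmetric.mp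
      ((specProj_star x l).isSelfAdjoint.sub hbsa))
    refine ⟨hsy.coe_re_inner_apply_self v, ?_⟩
    have hc : Filter.Tendsto (fun n => RCLike.re ⟪(specProj x (u n) - b) v, v⟫_ℂ) Filter.atTop
        (nhds (RCLike.re ⟪(specProj x l - b) v, v⟫_ℂ)) := by
      refine (RCLike.continuous_re.tendsto _).comp ?_
      refine Filter.Tendsto.inner ?_ tendsto_const_nhds
      simpa using (hlim v).sub_const (b v)
    exact ge_of_tendsto' hc (fun n => (hsa n).re_inner_nonneg_left v)

lemma specProj_family (x : H →L[ℂ] H) (hx : IsSelfAdjoint x) :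
    IsSpectralFamily x (specProj x) := by
  refine ⟨fun l => (specProj_star x l).isSelfAdjoint, fun l => (specProj_star x l).isIdempotentElem,
    fun l m h => (specProj_le_iff _ _ _ _).2 (specKer_mono x h), specProj_glb x,
    ⟨‖x‖ + 1, by positivity, ?_, ?_⟩, ?_⟩
  · intro l hl
    have : specKer x l = ⊥ := (Submodule.eq_bot_iff _).2 (fun v hv => supPos_ker_low x hx l hl v hv)
    simp only [specProj, this]
    exact Submodule.starProjection_bot
  · intro l hl
    have : specKer x l = ⊤ := (Submodule.eq_top_iff').2 (fun v => by
      rw [mem_specKer, supPos_high x l hl]; rfl)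
    simp only [specProj, this]
    exact Submodule.starProjection_top
  · intro l
    have hs := supPos_sub_supNeg x hx l
    have hN := IsSelfAdjoint.of_nonneg (supPos_nonneg x l)
    have hM := IsSelfAdjoint.of_nonneg (supNeg_nonneg x l)
    have hP := (specProj_star x l).isSelfAdjoint
    have h1 : SupPos x l * specProj x l = 0 := by
      ext v
      exact (specKer x l).starProjection_apply_mem v
    have h2 : specProj x l * SupNeg x l = SupNeg x l := by
      ext v
      refine Submodule.starProjection_eq_self_iff.2 ?_
      exact congrArg (fun T : H →L[ℂ] H => T v) (supPos_mul_supNeg x hx l)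
    have h3 : SupNeg x l * specProj x l = SupNeg x l := by
      have := congrArg star h2
      rwa [star_mul, hM.star_eq, hP.star_eq] at this
    have h4 : x = SupPos x l - SupNeg x l + l • 1 := by rw [hs]; abel
    have h5 : x * specProj x l = - SupNeg x l + l • specProj x l := by
      conv_lhs => enter [1]; rw [h4]
      rw [add_mul, sub_mul, h1, h3, smul_one_mul, zero_sub]
    have h6 : x * (1 - specProj x l) = SupPos x l + l • (1 - specProj x l) := by
      rw [mul_sub, h5, mul_one]
      conv_lhs => enter [1]; rw [h4]
      rw [smul_sub]; abel
    rw [h5, h6]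
    exact ⟨by simpa using supNeg_nonneg x l, by simpa using supPos_nonneg x l⟩

lemma family_unique (x : H →L[ℂ] H) (hx : IsSelfAdjoint x) (E : ℝ → H →L[ℂ] H)
    (hE : IsSpectralFamily x E) (l : ℝ) : E l = specProj x l := by
  obtain ⟨hsa, hid, -, hglb, -, hb⟩ := hE
  have hproj : ∀ l, IsStarProjection (E l) := fun l => ⟨hid l, hsa l⟩
  have hcomm : ∀ l, Commute x (E l) := by
    intro l
    have h1 : IsSelfAdjoint (x * E l) := by
      have h := IsSelfAdjoint.of_nonneg (sub_nonneg.mpr (hb l).1)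
      have h' : IsSelfAdjoint (l • E l) := (IsSelfAdjoint.all l).smul (hsa l)
      simpa using h'.sub h
    have := h1.star_eq
    rw [star_mul, hx.star_eq, (hsa l).star_eq] at this
    exact this.symm
  have hpos : ∀ l, SupPos x l = (x - l • 1) * (1 - E l) := by
    intro l
    apply supPos_unique x hx l _ ((l • 1 - x) * E l)
    · noncomm_ring
    · have hc : Commute (1 - E l) (l • (1 : H →L[ℂ] H) - x) := by
        refine Commute.sub_left (Commute.one_left _) (Commute.sub_right ?_ (hcomm l).symm)
        exact (Commute.one_right _).smul_right l
      calc (x - l • 1) * (1 - E l) * ((l • 1 - x) * E l)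
          = (x - l • 1) * ((1 - E l) * (l • 1 - x)) * E l := by noncomm_ring
        _ = (x - l • 1) * (l • 1 - x) * ((1 - E l) * E l) := by rw [hc.eq]; noncomm_ring
        _ = 0 := by rw [(hproj l).one_sub_mul_self, mul_zero]
    · have := sub_nonneg.mpr (hb l).2
      rw [sub_mul, smul_one_mul]; exact this
    · have := sub_nonneg.mpr (hb l).1
      rw [sub_mul, smul_one_mul]; exact this
  apply le_antisymm
  · rw [IsStarProjection.le_iff_mul_eq_left (hproj l) (specProj_star x l)]
    have : specProj x l * E l = E l := by
      ext v
      refine Submodule.starProjection_eq_self_iff.2 ?_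
      have h0 : SupPos x l * E l = 0 := by
        rw [hpos l, mul_assoc, (hproj l).one_sub_mul_self, mul_zero]
      exact congrArg (fun T : H →L[ℂ] H => T v) h0
    first
      | exact this
      | (have h := congrArg star this
         rwa [star_mul, (hsa l).star_eq, (specProj_star x l).isSelfAdjoint.star_eq] at h)
  · refine (hglb l).2 ?_
    rintro _ ⟨m, hm, rfl⟩
    rw [IsStarProjection.le_iff_mul_eq_left (specProj_star x l) (hproj m)]
    have : E m * specProj x l = specProj x l := by
      ext v
      set w := specProj x l v with hw
      have hwk : SupPos x l w = 0 := (specKer x l).starProjection_apply_mem v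
      have hcm : Commute (SupPos x l) (1 - E m) :=
        (Commute.one_right _).sub_right ((hcomm m).cfc_real _)
      set q := (1 - E m) w with hq
      have hqk : SupPos x l q = 0 := by
        rw [hq, ← mul_apply_eq_comp, hcm.eq, mul_apply_eq_comp, hwk,
          map_zero]
      have hqq : (1 - E m) q = q := by
        rw [hq, ← mul_apply_eq_comp, (hproj m).one_sub.isIdempotentElem.eq]
      have e1 : (x - m • 1) q = SupPos x m q := by
        conv_lhs => rw [← hqq]
        rw [hpos m]; rfl
      have e2 : SupPos x m q = 0 := supPos_ker_mono x (le_of_lt hm) q hqk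
      have e3 : (x - l • 1) q = - SupNeg x l q := by
        rw [← supPos_sub_supNeg x hx l]; simp [hqk]
      have e4 : SupNeg x l q = (l - m) • q := by
        rw [e2] at e1
        have a1 : x q = m • q := by simpa [sub_eq_zero] using e1
        have a2 : x q - l • q = - SupNeg x l q := by simpa using e3
        rw [a1] at a2
        rw [← neg_eq_iff_eq_neg] at a2
        rw [← a2, sub_smul]; abel
      have e5 := re_inner_nonneg _ (supNeg_nonneg x l) q
      rw [e4, ← Complex.coe_smul, inner_smul_left, inner_self_eq_norm_sq_to_K] at e5
      have e6 : 0 ≤ (l - m) * ‖q‖ ^ 2 := by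
        have : ((starRingEnd ℂ) ((l - m : ℝ) : ℂ) * ((‖q‖ : ℂ)) ^ 2) =
          (((l - m) * ‖q‖ ^ 2 : ℝ) : ℂ) := by rw [Complex.conj_ofReal]; push_cast; rfl
        erw [this, Complex.ofReal_re] at e5
        exact e5
      have hlm : l - m < 0 := sub_neg.mpr hm
      have e7 : ‖q‖ ^ 2 = 0 := by nlinarith [sq_nonneg ‖q‖]
      have e8 : q = 0 := by simpa using e7
      rw [hq] at e8
      have : w - E m w = 0 := by simpa using e8
      rw [mul_apply_eq_comp]
      exact (sub_eq_zero.mp this).symm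
    first
      | exact this
      | (have h := congrArg star this
         rwa [star_mul, (hsa m).star_eq, (specProj_star x l).isSelfAdjoint.star_eq] at h)

lemma specLE_iff (x y : H →L[ℂ] H) (hx : IsSelfAdjoint x) (hy : IsSelfAdjoint y) :
    SpecLE x y ↔ ∀ l, specKer y l ≤ specKer x l := by
  constructor
  · intro h l
    exact (specProj_le_iff _ _ _ _).1 (h _ _ (specProj_family x hx) (specProj_family y hy) l)
  · intro h E F hE hF l
    rw [family_unique x hx E hE, family_unique y hy F hF]
    exact (specProj_le_iff _ _ _ _).2 (h l)

lemma supPos_mul_zero (x y : H →L[ℂ] H) (hx : IsSelfAdjoint x)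
    (hxy : x * y = 0) (l : ℝ) (hl : 0 ≤ l) : SupPos x l * y = 0 := by
  have h0 : SupPos x 0 * y = 0 := by
    have hs := supPos_sub_supNeg x hx 0
    rw [zero_smul, sub_zero] at hs
    have h1 : SupPos x 0 * (SupPos x 0 * y) = 0 := by
      have : SupPos x 0 * x = SupPos x 0 * SupPos x 0 := by
        conv_lhs => enter [2]; rw [← hs]
        rw [mul_sub, supPos_mul_supNeg x hx, sub_zero]
      rw [← mul_assoc, ← this, mul_assoc, hxy, mul_zero]
    have h2 : star (SupPos x 0 * y) * (SupPos x 0 * y) = 0 := by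
      rw [star_mul, (IsSelfAdjoint.of_nonneg (supPos_nonneg x 0)).star_eq, mul_assoc, h1, mul_zero]
    exact CStarRing.star_mul_self_eq_zero_iff _ |>.mp h2
  ext v
  exact supPos_ker_mono x hl (y v) (by rw [← mul_apply_eq_comp, h0]; rfl)

lemma supPos_mul_supPos (x y : H →L[ℂ] H) (hx : IsSelfAdjoint x) (hy : IsSelfAdjoint y)
    (hxy : x * y = 0) (l m : ℝ) (hl : 0 ≤ l) (hm : 0 ≤ m) : SupPos x l * SupPos y m = 0 := by
  have h1 := supPos_mul_zero x y hx hxy l hl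
  have h2 := congrArg star h1
  have hX := IsSelfAdjoint.of_nonneg (supPos_nonneg x l)
  have hY := IsSelfAdjoint.of_nonneg (supPos_nonneg y m)
  rw [star_mul, hX.star_eq, hy.star_eq, star_zero] at h2
  have h3 := congrArg star (supPos_mul_zero y _ hy h2 m hm)
  rwa [star_mul, hX.star_eq, hY.star_eq, star_zero] at h3

lemma supPos_min_le (x : H →L[ℂ] H) (hx : IsSelfAdjoint x) (l : ℝ) (hl : 0 ≤ l) :
    0 ≤ l • 1 - (SupPos x 0 - SupPos x l) ∧
    SupPos x l * (l • 1 - (SupPos x 0 - SupPos x l)) = 0 := by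
  have h : l • (1 : H →L[ℂ] H) - (SupPos x 0 - SupPos x l) =
      cfc (fun t : ℝ => l - (max (t - 0) 0 - max (t - l) 0)) x := by
    rw [cfc_sub _ _ x (by fun_prop) (by fun_prop), cfc_sub _ _ x (by fun_prop) (by fun_prop),
      cfc_const l x, Algebra.algebraMap_eq_smul_one]
  rw [h]
  constructor
  · refine cfc_nonneg (fun t _ => ?_)
    rcases le_total t l with h | h <;> rcases le_total t 0 with h' | h' <;>
      simp [h, h'] <;> linarith
  · rw [SupPos, ← cfc_mul _ _ x (by fun_prop) (by fun_prop), ← cfc_zero ℝ x]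
    congr 1
    ext t
    rcases le_total t l with h | h
    · rw [max_eq_right (by linarith : t - l ≤ 0)]; simp
    · rw [max_eq_left (by linarith : 0 ≤ t - l), max_eq_left (by linarith : 0 ≤ t - 0)]
      simp

lemma supPos_sum (x y : H →L[ℂ] H) (hx : IsSelfAdjoint x) (hy : IsSelfAdjoint y)
    (hxy : x * y = 0) (hyx : y * x = 0) (l : ℝ) (hl : 0 ≤ l) :
    SupPos (SupPos x 0 + SupPos y 0) l = SupPos x l + SupPos y l := by
  have hw : IsSelfAdjoint (SupPos x 0 + SupPos y 0) :=
    IsSelfAdjoint.of_nonneg (add_nonneg (supPos_nonneg x 0) (supPos_nonneg y 0))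
  have c := fun a b ha hb => supPos_mul_supPos x y hx hy hxy a b ha hb
  have d := fun a b ha hb => supPos_mul_supPos y x hy hx hyx a b ha hb
  obtain ⟨hx1, hx2⟩ := supPos_min_le x hx l hl
  obtain ⟨hy1, hy2⟩ := supPos_min_le y hy l hl
  have hGG : (SupPos x 0 - SupPos x l) * (SupPos y 0 - SupPos y l) = 0 := by
    rw [mul_sub, sub_mul, sub_mul, c _ _ le_rfl le_rfl, c _ _ hl le_rfl, c _ _ le_rfl hl,
      c _ _ hl hl]; simp
  have hGG' : (SupPos y 0 - SupPos y l) * (SupPos x 0 - SupPos x l) = 0 := by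
    rw [mul_sub, sub_mul, sub_mul, d _ _ le_rfl le_rfl, d _ _ hl le_rfl, d _ _ le_rfl hl,
      d _ _ hl hl]; simp
  apply supPos_unique _ hw l _
    (l • 1 - (SupPos x 0 - SupPos x l) - (SupPos y 0 - SupPos y l))
  · abel
  · rw [add_mul, mul_sub, hx2, mul_sub (SupPos x l), c _ _ hl le_rfl, c _ _ hl hl]
    rw [sub_right_comm, mul_sub (SupPos y l), hy2, mul_sub (SupPos y l), d _ _ hl le_rfl,
      d _ _ hl hl]
    simp
  · exact add_nonneg (supPos_nonneg x l) (supPos_nonneg y l)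
  · rcases hl.eq_or_lt with rfl | hl'
    · simp
    · generalize SupPos x 0 - SupPos x l = A at *
      generalize SupPos y 0 - SupPos y l = B at *
      have e : (l • (1 : H →L[ℂ] H) - A) * (l • 1 - B) = l • (l • 1 - A - B) := by
        simp only [sub_mul, mul_sub, smul_mul_assoc, mul_smul_comm, one_mul, mul_one, hGG, smul_sub]
        abel
      have e' : (l • (1 : H →L[ℂ] H) - B) * (l • 1 - A) = l • (l • 1 - A - B) := by
        simp only [sub_mul, mul_sub, smul_mul_assoc, mul_smul_comm, one_mul, mul_one, hGG', smul_sub]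
        abel
      have hn : 0 ≤ l • (l • 1 - A - B) := by
        rw [← e]
        exact Commute.mul_nonneg hx1 hy1 (e.trans e'.symm)
      have := smul_nonneg (inv_nonneg.mpr hl) hn
      rwa [smul_smul, inv_mul_cancel₀ hl'.ne', one_smul] at this

lemma neg_ker_range (x : H →L[ℂ] H) (hx : IsSelfAdjoint x) (l : ℝ) (hl : l < 0) (v : H)
    (hv : SupPos x l v = 0) : ∃ u, v = x u := by
  have hne : ∀ t : ℝ, min t l ≠ 0 := fun t => (lt_of_le_of_lt (min_le_right t l) hl).ne
  have hcont : Continuous (fun t : ℝ => (min t l)⁻¹) :=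
    Continuous.inv₀ (by fun_prop) hne
  have h : (1 : H →L[ℂ] H) = x * cfc (fun t : ℝ => (min t l)⁻¹) x - l⁻¹ • SupPos x l := by
    conv_rhs => enter [1, 1]; rw [← cfc_id' ℝ x]
    rw [← cfc_mul _ _ x (by fun_prop) hcont.continuousOn, ← cfc_smul _ _ x (by fun_prop),
      ← cfc_sub (fun t : ℝ => t * (min t l)⁻¹) _ x
        ((continuous_id.mul hcont).continuousOn) (by fun_prop), ← cfc_one ℝ x]
    congr 1
    ext t
    simp only [smul_eq_mul, Pi.one_apply]
    rcases le_total t l with h | h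
    · rw [min_eq_left h, max_eq_right (by linarith), mul_inv_cancel₀ (by linarith : t < 0).ne]
      simp
    · rw [min_eq_right h, max_eq_left (by linarith)]
      have := mul_inv_cancel₀ hl.ne
      linear_combination -this
  refine ⟨cfc (fun t : ℝ => (min t l)⁻¹) x v, ?_⟩
  have := congrArg (fun T : H →L[ℂ] H => T v) h
  simpa [hv] using this

/-- If `x y` are orthogonal self-adjoint operators, then `x⁺ + y⁺` is the supremum of
`{x, y}` in the spectral order. -/
theorem stmt13 (x y : H →L[ℂ] H) (hx : IsSelfAdjoint x) (hy : IsSelfAdjoint y)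
    (hxy : x * y = 0) :
    SpecLE x (cfc (fun t : ℝ => max t 0) x + cfc (fun t : ℝ => max t 0) y) ∧
    SpecLE y (cfc (fun t : ℝ => max t 0) x + cfc (fun t : ℝ => max t 0) y) ∧
    ∀ z : H →L[ℂ] H, IsSelfAdjoint z → SpecLE x z → SpecLE y z →
      SpecLE (cfc (fun t : ℝ => max t 0) x + cfc (fun t : ℝ => max t 0) y) z := by
  have hyx : y * x = 0 := by
    have := congrArg star hxy
    rwa [star_mul, hx.star_eq, hy.star_eq, star_zero] at this
  have ex : ∀ a : H →L[ℂ] H, cfc (fun t : ℝ => max t 0) a = SupPos a 0 := fun a => by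
    simp only [SupPos, sub_zero]
  rw [ex x, ex y]
  have hw0 := add_nonneg (supPos_nonneg x 0) (supPos_nonneg y 0)
  have hw := IsSelfAdjoint.of_nonneg hw0
  have hneg : ∀ l < 0, ∀ v, SupPos (SupPos x 0 + SupPos y 0) l v = 0 → v = 0 := by
    intro l hl v hv
    have hu : SupPos (SupPos x 0 + SupPos y 0) l = SupPos x 0 + SupPos y 0 - l • 1 := by
      apply supPos_unique _ hw l _ 0 (by simp) (by simp) _ le_rfl
      rw [sub_eq_add_neg, ← neg_smul]
      exact add_nonneg hw0 (smul_nonneg (by linarith) zero_le_one)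
    rw [hu] at hv
    have h1 : (SupPos x 0 + SupPos y 0) v = l • v := by simpa [sub_eq_zero] using hv
    have h2 := re_inner_nonneg _ hw0 v
    rw [h1, ← Complex.coe_smul, inner_smul_left, Complex.conj_ofReal, Complex.re_ofReal_mul] at h2
    have h3 : (⟪v, v⟫_ℂ).re = ‖v‖ ^ 2 := inner_self_eq_norm_sq (𝕜 := ℂ) v
    rw [h3] at h2
    have : ‖v‖ ^ 2 = 0 := by nlinarith [sq_nonneg ‖v‖]
    simpa using this
  have hker : ∀ l, 0 ≤ l → ∀ v, SupPos (SupPos x 0 + SupPos y 0) l v = 0 ↔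
      SupPos x l v = 0 ∧ SupPos y l v = 0 := by
    intro l hl v
    rw [supPos_sum x y hx hy hxy hyx l hl]
    constructor
    · intro h
      have h1 := re_inner_nonneg _ (supPos_nonneg x l) v
      have h2 := re_inner_nonneg _ (supPos_nonneg y l) v
      have h3 : (⟪(SupPos x l + SupPos y l) v, v⟫_ℂ).re = 0 := by rw [h]; simp
      rw [add_apply, inner_add_left, Complex.add_re] at h3
      exact ⟨apply_eq_zero_of_nonneg _ (supPos_nonneg x l) v (by linarith),
        apply_eq_zero_of_nonneg _ (supPos_nonneg y l) v (by linarith)⟩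
    · rintro ⟨h1, h2⟩
      rw [add_apply, h1, h2, add_zero]
  refine ⟨?_, ?_, ?_⟩
  · rw [specLE_iff _ _ hx hw]
    intro l v hv
    rw [mem_specKer] at hv ⊢
    rcases lt_or_ge l 0 with hl | hl
    · rw [hneg l hl v hv, map_zero]
    · exact ((hker l hl v).1 hv).1
  · rw [specLE_iff _ _ hy hw]
    intro l v hv
    rw [mem_specKer] at hv ⊢
    rcases lt_or_ge l 0 with hl | hl
    · rw [hneg l hl v hv, map_zero]
    · exact ((hker l hl v).1 hv).2
  · intro z hz hxz hyz
    rw [specLE_iff _ _ hx hz] at hxz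
    rw [specLE_iff _ _ hy hz] at hyz
    rw [specLE_iff _ _ hw hz]
    intro l v hv
    have h1 := hxz l hv
    have h2 := hyz l hv
    rw [mem_specKer] at h1 h2 ⊢
    rcases lt_or_ge l 0 with hl | hl
    · obtain ⟨u, hu⟩ := neg_ker_range x hx l hl v h1
      obtain ⟨u', hu'⟩ := neg_ker_range y hy l hl v h2
      have hvv : ⟪v, v⟫_ℂ = 0 := by
        conv_lhs => rw [hu]; enter [2]; rw [← hu, hu']
        rw [← ContinuousLinearMap.adjoint_inner_right, ← ContinuousLinearMap.star_eq_adjoint,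
          hy.star_eq, ← mul_apply_eq_comp, hyx]
        simp
      rw [inner_self_eq_zero.mp hvv, map_zero]
    · exact (hker l hl v).2 ⟨h1, h2⟩
end
end
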